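/- Fisher information dissipation inequality (differential form of Theorem 2.2): assume there exists λ > 0 such that ⟨ℜ(x) v, v⟩ ≥ λ ‖v‖² for every x ∈ ℝ^d and every v ∈ ℝ^d. Let f : ℝ^d → ℝ be smooth with compact support, set p := π·e^f, b := ∇ log π − γ, and σ := −∇·(p b) + Δp. Then ∫_{ℝ^d} ( 2⟨∇f(x), ∇(σ/p)(x)⟩ p(x) + ‖∇f(x)‖² σ(x) ) dx ≤ −2λ ∫_{ℝ^d} ‖∇f(x)‖² p(x) dx; that is, the time derivative of the relative Fisher information along the Fokker–Planck equation ∂_t p = −∇·(p b) + Δp is at most −2λ times the relative Fisher information. -/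

import Mathlib

open MeasureTheory
open scoped BigOperators

noncomputable section

/-- `i`-th partial derivative of `f` at `x`, in the coordinate direction `i`. -/
def pderiv' {d : ℕ} (f : EuclideanSpace ℝ (Fin d) → ℝ) (i : Fin d)
    (x : EuclideanSpace ℝ (Fin d)) : ℝ :=
  fderiv ℝ f x (EuclideanSpace.single i 1)

/-- second partial derivative `∂_i ∂_j f` at `x`. -/
def pderiv2 {d : ℕ} (f : EuclideanSpace ℝ (Fin d) → ℝ) (i j : Fin d)
    (x : EuclideanSpace ℝ (Fin d)) : ℝ :=
  pderiv' (fun y => pderiv' f j y) i x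

/-- Laplacian `Δf`. -/
def lap {d : ℕ} (f : EuclideanSpace ℝ (Fin d) → ℝ) (x : EuclideanSpace ℝ (Fin d)) : ℝ :=
  ∑ i, pderiv2 f i i x

/-- carré du champ `Γ₁(g,h) = ⟨∇g, ∇h⟩`. -/
def Gamma1 {d : ℕ} (g h : EuclideanSpace ℝ (Fin d) → ℝ) (x : EuclideanSpace ℝ (Fin d)) : ℝ :=
  ∑ i, pderiv' g i x * pderiv' h i x

/-- generator `L̃ h = ⟨∇ log π, ∇h⟩ + Δh`. -/
def genL {d : ℕ} (π h : EuclideanSpace ℝ (Fin d) → ℝ) (x : EuclideanSpace ℝ (Fin d)) : ℝ :=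
  Gamma1 (fun y => Real.log (π y)) h x + lap h x

/-- Gamma two operator `Γ₂(f,f) = ½ L̃ Γ₁(f,f) − Γ₁(L̃f, f)`. -/
def Gamma2 {d : ℕ} (π f : EuclideanSpace ℝ (Fin d) → ℝ) (x : EuclideanSpace ℝ (Fin d)) : ℝ :=
  (1/2 : ℝ) * genL π (fun y => Gamma1 f f y) x - Gamma1 (fun y => genL π f y) f x

/-- information Gamma operator `Γ_I(f,f) = −½⟨γ, ∇Γ₁(f,f)⟩ + (L̃f)·⟨∇f, γ⟩`. -/
def GammaI {d : ℕ} (π : EuclideanSpace ℝ (Fin d) → ℝ)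
    (γ : EuclideanSpace ℝ (Fin d) → EuclideanSpace ℝ (Fin d))
    (f : EuclideanSpace ℝ (Fin d) → ℝ) (x : EuclideanSpace ℝ (Fin d)) : ℝ :=
  -(1/2 : ℝ) * (∑ i, γ x i * pderiv' (fun y => Gamma1 f f y) i x)
    + genL π f x * (∑ i, pderiv' f i x * γ x i)

/-- the tensor `ℜ` of the paper:
`ℜ_{ij} = −∂²_{ij} log π + ((3−2d)/8) γ_i γ_j − (1/8) δ_{ij} Σ_k γ_k²
          + ½(γ_i ∂_j log π + γ_j ∂_i log π)`. -/
def Rtensor {d : ℕ} (π : EuclideanSpace ℝ (Fin d) → ℝ)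
    (γ : EuclideanSpace ℝ (Fin d) → EuclideanSpace ℝ (Fin d))
    (i j : Fin d) (x : EuclideanSpace ℝ (Fin d)) : ℝ :=
  -pderiv2 (fun y => Real.log (π y)) i j x
    + ((3 - 2 * (d : ℝ)) / 8) * γ x i * γ x j
    - (1/8 : ℝ) * (if i = j then ∑ k, (γ x k) ^ 2 else 0)
    + (1/2 : ℝ) * (γ x i * pderiv' (fun y => Real.log (π y)) j x
        + γ x j * pderiv' (fun y => Real.log (π y)) i x)

/-- the modified Hessian matrix `𝔥ess f`. -/
def hessM {d : ℕ} (γ : EuclideanSpace ℝ (Fin d) → EuclideanSpace ℝ (Fin d))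
    (f : EuclideanSpace ℝ (Fin d) → ℝ) (i j : Fin d) (x : EuclideanSpace ℝ (Fin d)) : ℝ :=
  if i = j then
    pderiv2 f i i x + (1/2 : ℝ) * (∑ k, γ x k * pderiv' f k x)
      - (1/2 : ℝ) * γ x i * pderiv' f i x
  else
    pderiv2 f i j x - (1/4 : ℝ) * (γ x i * pderiv' f j x + γ x j * pderiv' f i x)

/-- right-hand side of the Fokker–Planck equation `−∇·(p b) + Δp` with drift
`b = ∇ log π − γ`, evaluated at a density `p`. -/
def FPrhs {d : ℕ} (π : EuclideanSpace ℝ (Fin d) → ℝ)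
    (γ : EuclideanSpace ℝ (Fin d) → EuclideanSpace ℝ (Fin d))
    (p : EuclideanSpace ℝ (Fin d) → ℝ) (x : EuclideanSpace ℝ (Fin d)) : ℝ :=
  -(∑ i, pderiv' (fun y => p y * (pderiv' (fun z => Real.log (π z)) i y - γ y i)) i x)
    + lap p x

/-- `L̃* p = −∇·(p ∇ log π) + Δp`. -/
def Ltilstar {d : ℕ} (π p : EuclideanSpace ℝ (Fin d) → ℝ)
    (x : EuclideanSpace ℝ (Fin d)) : ℝ :=
  -(∑ i, pderiv' (fun y => p y * pderiv' (fun z => Real.log (π z)) i y) i x) + lap p x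

/-- Arnold–Carlen tensor `(ℜ_AC)_{ij} = −∂²_{ij} log π − ½(∂_i γ_j + ∂_j γ_i)`. -/
def RAC {d : ℕ} (π : EuclideanSpace ℝ (Fin d) → ℝ)
    (γ : EuclideanSpace ℝ (Fin d) → EuclideanSpace ℝ (Fin d))
    (i j : Fin d) (x : EuclideanSpace ℝ (Fin d)) : ℝ :=
  -pderiv2 (fun y => Real.log (π y)) i j x
    - (1/2 : ℝ) * (pderiv' (fun y => γ y j) i x + pderiv' (fun y => γ y i) j x)


section PartialDerivatives

open scoped ContDiff

variable {d : ℕ} {f g : EuclideanSpace ℝ (Fin d) → ℝ}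

lemma ContDiff.pderiv' (hf : ContDiff ℝ ∞ f) (i : Fin d) :
    ContDiff ℝ ∞ (_root_.pderiv' f i) :=
  (hf.fderiv_right (m := ∞) (by simp)).clm_apply contDiff_const

lemma pderiv'_add (hf : ContDiff ℝ ∞ f) (hg : ContDiff ℝ ∞ g) (i : Fin d)
    (x : EuclideanSpace ℝ (Fin d)) :
    pderiv' (fun y => f y + g y) i x = pderiv' f i x + pderiv' g i x := by
  simp only [pderiv']
  rw [fderiv_fun_add (hf.differentiable (by simp) x) (hg.differentiable (by simp) x)]
  rfl

lemma pderiv'_sub (hf : ContDiff ℝ ∞ f) (hg : ContDiff ℝ ∞ g) (i : Fin d)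
    (x : EuclideanSpace ℝ (Fin d)) :
    pderiv' (fun y => f y - g y) i x = pderiv' f i x - pderiv' g i x := by
  simp only [pderiv']
  rw [fderiv_fun_sub (hf.differentiable (by simp) x) (hg.differentiable (by simp) x)]
  rfl

lemma pderiv'_mul (hf : ContDiff ℝ ∞ f) (hg : ContDiff ℝ ∞ g) (i : Fin d)
    (x : EuclideanSpace ℝ (Fin d)) :
    pderiv' (fun y => f y * g y) i x = f x * pderiv' g i x + g x * pderiv' f i x := by
  simp only [pderiv']
  rw [fderiv_fun_mul (hf.differentiable (by simp) x) (hg.differentiable (by simp) x)]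
  rfl

lemma pderiv'_const_mul (hf : ContDiff ℝ ∞ f) (c : ℝ) (i : Fin d)
    (x : EuclideanSpace ℝ (Fin d)) :
    pderiv' (fun y => c * f y) i x = c * pderiv' f i x := by
  simp only [pderiv']
  rw [fderiv_const_mul (hf.differentiable (by simp) x)]
  rfl

lemma pderiv'_sum {ι : Type*} [Fintype ι] {F : ι → EuclideanSpace ℝ (Fin d) → ℝ}
    (hF : ∀ k, ContDiff ℝ ∞ (F k)) (i : Fin d) (x : EuclideanSpace ℝ (Fin d)) :
    pderiv' (fun y => ∑ k, F k y) i x = ∑ k, pderiv' (F k) i x := by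
  simp only [pderiv']
  rw [fderiv_fun_sum fun k _ => (hF k).differentiable (by simp) x]
  simp

lemma pderiv'_exp (hf : ContDiff ℝ ∞ f) (i : Fin d) (x : EuclideanSpace ℝ (Fin d)) :
    pderiv' (fun y => Real.exp (f y)) i x = Real.exp (f x) * pderiv' f i x := by
  simp only [pderiv']
  rw [fderiv_exp (hf.differentiable (by simp) x)]
  rfl

lemma pderiv'_comm (hf : ContDiff ℝ ∞ f) (i j : Fin d) (x : EuclideanSpace ℝ (Fin d)) :
    pderiv' (pderiv' f i) j x = pderiv' (pderiv' f j) i x := by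
  have hd : DifferentiableAt ℝ (fderiv ℝ f) x :=
    (hf.fderiv_right (m := ∞) (by simp)).differentiable (by simp) x
  have key : ∀ v w : EuclideanSpace ℝ (Fin d),
      fderiv ℝ (fun y => fderiv ℝ f y v) x w = fderiv ℝ (fderiv ℝ f) x w v := by
    intro v w
    rw [fderiv_clm_apply hd (by fun_prop)]
    simp
  have hs : IsSymmSndFDerivAt ℝ f x :=
    hf.contDiffAt.isSymmSndFDerivAt
      (by rw [minSmoothness_of_isRCLikeNormedField]; exact WithTop.coe_le_coe.2 le_top)
  exact (key _ _).trans ((hs.eq _ _).trans (key _ _).symm)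

lemma pderiv'_eq_zero_of_notMem_tsupport (i : Fin d) {x : EuclideanSpace ℝ (Fin d)}
    (hx : x ∉ tsupport f) : pderiv' f i x = 0 := by
  simp [pderiv', fderiv_of_notMem_tsupport (𝕜 := ℝ) hx]

lemma integrable_of_contDiff (hf : ContDiff ℝ ∞ f) (hfc : HasCompactSupport f) :
    Integrable f :=
  hf.continuous.integrable_of_hasCompactSupport hfc

lemma integrable_pderiv' (hf : ContDiff ℝ ∞ f) (hfc : HasCompactSupport f) (i : Fin d) :
    Integrable (pderiv' f i) :=
  integrable_of_contDiff (hf.pderiv' i) (hfc.fderiv_apply ℝ _)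

lemma integral_pderiv'_eq_zero (hf : ContDiff ℝ ∞ f) (hfc : HasCompactSupport f) (i : Fin d) :
    ∫ x, pderiv' f i x = 0 := by
  have h := integral_mul_fderiv_eq_neg_fderiv_mul_of_integrable (μ := volume)
    (f := fun _ : EuclideanSpace ℝ (Fin d) => (1 : ℝ)) (g := f)
    (v := EuclideanSpace.single i 1) (by simp)
    (by simp only [one_mul]; exact integrable_pderiv' hf hfc i)
    (by simpa using integrable_of_contDiff hf hfc)
    (fun _ _ => by fun_prop) (fun x _ => hf.differentiable (by simp) x)
  simpa [pderiv'] using h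

end PartialDerivatives

section PointwiseAlgebra

variable {d : ℕ}

/-- Algebraic form of the generalised Bochner formula: `g`, `c`, `u` stand for `∇f`, `γ`,
`∇ log π`, while `H`, `U`, `C`, `T` stand for `∇²f`, `∇² log π`, `∂ᵢγⱼ` and `∂ᵢ∂ⱼ∂ⱼf`. -/
lemma bochner_divergence_identity (g c u : Fin d → ℝ) (H U C T : Fin d → Fin d → ℝ)
    (hH : ∀ i j, H i j = H j i) (hdiv : ∑ i, (u i * c i + C i i) = 0) :
    2 * ∑ j, g j * ∑ k, (u k * H j k + g k * U j k + T j k + 2 * (g k * H j k)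
            + (c k * H j k + g k * C j k))
        + (∑ k, g k * g k) * ∑ k, (u k * g k + H k k + g k * g k + c k * g k)
      - ∑ i, ((u i + g i) * (2 * ((∑ k, c k * g k) * g i) - (∑ k, g k * g k) * c i
            + (∑ k, g k * g k) * g i + 2 * ∑ k, g k * H i k)
          + (2 * ((∑ k, c k * g k) * H i i + g i * ∑ k, (c k * H i k + g k * C i k))
            - ((∑ k, g k * g k) * C i i + c i * (2 * ∑ k, g k * H i k))
            + ((∑ k, g k * g k) * H i i + g i * (2 * ∑ k, g k * H i k))
            + 2 * ∑ k, (g k * T k i + H i k * H i k)))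
      = -2 * (∑ i, ∑ j, H i j * H i j - ∑ i, ∑ j, c i * g j * H i j
          + (∑ k, c k * g k) * ∑ k, H k k - ∑ i, ∑ j, U i j * g i * g j
          + (∑ k, u k * g k) * ∑ k, c k * g k) := by
  set G := ∑ k, g k * g k with hG
  set s := ∑ k, c k * g k with hs
  set t := ∑ k, H k k with ht
  set a := ∑ k, u k * g k with ha
  have e1 : ∑ j, g j * ∑ k, (u k * H j k + g k * U j k + T j k + 2 * (g k * H j k)
            + (c k * H j k + g k * C j k))
      = ∑ j, ∑ k, u j * g k * H j k + ∑ j, ∑ k, U j k * g j * g k + ∑ j, ∑ k, g j * T j k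
        + 2 * ∑ j, ∑ k, g j * g k * H j k + ∑ j, ∑ k, c j * g k * H j k
        + ∑ j, ∑ k, g j * g k * C j k := by
    have q1 : ∑ j, ∑ k, u j * g k * H j k = ∑ j, ∑ k, u k * g j * H j k := by
      rw [Finset.sum_comm]; simp only [hH]
    have q2 : ∑ j, ∑ k, c j * g k * H j k = ∑ j, ∑ k, c k * g j * H j k := by
      rw [Finset.sum_comm]; simp only [hH]
    rw [q1, q2]
    simp only [Finset.mul_sum, ← Finset.sum_add_distrib]
    refine Finset.sum_congr rfl fun j _ => Finset.sum_congr rfl fun k _ => ?_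
    ring
  have e2 : ∑ k, (u k * g k + H k k + g k * g k + c k * g k) = a + t + G + s := by
    simp only [Finset.sum_add_distrib, hG, hs, ht, ha]
  have e3 : ∑ i, ((u i + g i) * (2 * (s * g i) - G * c i + G * g i + 2 * ∑ k, g k * H i k)
          + (2 * (s * H i i + g i * ∑ k, (c k * H i k + g k * C i k))
            - (G * C i i + c i * (2 * ∑ k, g k * H i k))
            + (G * H i i + g i * (2 * ∑ k, g k * H i k))
            + 2 * ∑ k, (g k * T k i + H i k * H i k)))
      = 2 * s * (a + G) - G * (∑ i, (u i * c i + C i i)) - G * s + G * (a + G)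
        + 2 * ∑ j, ∑ k, u j * g k * H j k + 2 * ∑ j, ∑ k, g j * g k * H j k
        + 2 * s * t + 2 * ∑ j, ∑ k, c j * g k * H j k + 2 * ∑ j, ∑ k, g j * g k * C j k
        - 2 * ∑ j, ∑ k, c j * g k * H j k + G * t + 2 * ∑ j, ∑ k, g j * g k * H j k
        + 2 * ∑ j, ∑ k, g j * T j k + 2 * ∑ j, ∑ k, H j k * H j k := by
    have q1 : ∑ j, ∑ k, c j * g k * H j k = ∑ j, ∑ k, c k * g j * H j k := by
      rw [Finset.sum_comm]; simp only [hH]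
    have q2 : ∑ j, ∑ k, g j * T j k = ∑ j, ∑ k, g k * T k j := Finset.sum_comm
    have q3 : ∑ i, (u i + g i) * (2 * (s * g i) - G * c i + G * g i)
        + ∑ i, (2 * (s * H i i) - G * C i i + G * H i i)
        = 2 * s * (a + G) - G * (∑ i, (u i * c i + C i i)) - G * s + G * (a + G)
          + 2 * s * t + G * t := by
      rw [show 2 * s * (a + G) - G * (∑ i, (u i * c i + C i i)) - G * s + G * (a + G)
          + 2 * s * t + G * t
          = (2 * s + G) * ∑ k, u k * g k + (2 * s + G) * ∑ k, g k * g k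
            - G * (∑ i, (u i * c i + C i i)) - G * (∑ k, c k * g k)
            + (2 * s + G) * ∑ k, H k k by rw [← hs, ← ha, ← ht, ← hG]; ring]
      simp only [Finset.mul_sum, ← Finset.sum_add_distrib, ← Finset.sum_sub_distrib]
      refine Finset.sum_congr rfl fun j _ => ?_
      ring
    have q4 : ∑ i, ((u i + g i) * (2 * ∑ k, g k * H i k)
          + 2 * (g i * ∑ k, (c k * H i k + g k * C i k)) - c i * (2 * ∑ k, g k * H i k)
          + g i * (2 * ∑ k, g k * H i k) + 2 * ∑ k, (g k * T k i + H i k * H i k))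
        = 2 * ∑ j, ∑ k, u j * g k * H j k + 2 * ∑ j, ∑ k, g j * g k * H j k
        + 2 * ∑ j, ∑ k, c k * g j * H j k + 2 * ∑ j, ∑ k, g j * g k * C j k
        - 2 * ∑ j, ∑ k, c j * g k * H j k + 2 * ∑ j, ∑ k, g j * g k * H j k
        + 2 * ∑ j, ∑ k, g k * T k j + 2 * ∑ j, ∑ k, H j k * H j k := by
      simp only [Finset.mul_sum, ← Finset.sum_add_distrib, ← Finset.sum_sub_distrib]
      refine Finset.sum_congr rfl fun j _ => Finset.sum_congr rfl fun k _ => ?_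
      ring
    rw [← q1, ← q2] at q4
    have q5 := congrArg₂ (· + ·) q3 q4
    simp only [← Finset.sum_add_distrib] at q5
    refine Eq.trans (Finset.sum_congr rfl fun i _ => ?_) (q5.trans ?_) <;> ring
  rw [e1, e2, e3, hdiv]
  ring

/-- Completing the square in the generalised Bochner formula with the modified Hessian
`H + ½⟨c, g⟩ I - ¼ (c gᵀ + g cᵀ)`. -/
lemma modified_hessian_lower_bound (g c : Fin d → ℝ) (H : Fin d → Fin d → ℝ)
    (hH : ∀ i j, H i j = H j i) :
    (3 - 2 * (d : ℝ)) / 8 * (∑ k, c k * g k) ^ 2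
        - 1 / 8 * ((∑ k, c k ^ 2) * ∑ k, g k * g k)
      ≤ ∑ i, ∑ j, H i j * H i j - ∑ i, ∑ j, c i * g j * H i j
          + (∑ k, c k * g k) * ∑ k, H k k := by
  set s := ∑ k, c k * g k with hs
  have key : ∑ i, ∑ j, (H i j + (if i = j then s / 2 else 0) - (c i * g j + c j * g i) / 4) ^ 2
      = ∑ i, ∑ j, H i j * H i j - ∑ i, ∑ j, c i * g j * H i j + s * ∑ k, H k k
        - ((3 - 2 * (d : ℝ)) / 8 * s ^ 2 - 1 / 8 * ((∑ k, c k ^ 2) * ∑ k, g k * g k)) := by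
    have expand : ∀ i j,
        (H i j + (if i = j then s / 2 else 0) - (c i * g j + c j * g i) / 4) ^ 2
        = H i j * H i j - 1 / 2 * (c i * g j * H i j) - 1 / 2 * (c j * g i * H i j)
          + (if i = j then s * H i j + s ^ 2 / 4 - s * (c i * g j) / 4 - s * (c j * g i) / 4 else 0)
          + 1 / 16 * (c i ^ 2 * (g j * g j)) + 1 / 16 * ((g i * g i) * c j ^ 2)
          + 1 / 8 * ((c i * g i) * (c j * g j)) := by
      intro i j
      split_ifs <;> ring
    have q1 : ∑ i, ∑ j, c j * g i * H i j = ∑ i, ∑ j, c i * g j * H i j := by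
      rw [Finset.sum_comm]; simp only [hH]
    have q2 : ∑ i, (s * H i i + s ^ 2 / 4 - s * (c i * g i) / 4 - s * (c i * g i) / 4)
        = s * ∑ k, H k k + d * (s ^ 2 / 4) - s ^ 2 / 2 := by
      have : ∑ i, (s * H i i + s ^ 2 / 4 - s * (c i * g i) / 4 - s * (c i * g i) / 4)
        = s * ∑ k, H k k + d * (s ^ 2 / 4) - s / 2 * ∑ k, c k * g k := by
        rw [show (d : ℝ) * (s ^ 2 / 4) = ∑ _i : Fin d, s ^ 2 / 4 by simp]
        simp only [Finset.mul_sum, ← Finset.sum_add_distrib, ← Finset.sum_sub_distrib]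
        refine Finset.sum_congr rfl fun j _ => ?_
        ring
      rw [this, ← hs]; ring
    simp only [expand, Finset.sum_add_distrib, Finset.sum_sub_distrib, ← Finset.mul_sum,
      ← Finset.sum_mul, Finset.sum_ite_eq, Finset.mem_univ, if_true]
    rw [q1]
    simp only [Finset.sum_add_distrib, Finset.sum_sub_distrib, ← Finset.mul_sum] at q2
    rw [q2, ← hs]
    ring
  have hnn : 0 ≤ ∑ i, ∑ j,
      (H i j + (if i = j then s / 2 else 0) - (c i * g j + c j * g i) / 4) ^ 2 := by positivity
  linarith

lemma Rtensor_quadratic_form (π : EuclideanSpace ℝ (Fin d) → ℝ)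
    (γ : EuclideanSpace ℝ (Fin d) → EuclideanSpace ℝ (Fin d))
    (x : EuclideanSpace ℝ (Fin d)) (v : Fin d → ℝ) :
    ∑ i, ∑ j, Rtensor π γ i j x * v i * v j
      = -(∑ i, ∑ j, pderiv2 (fun y => Real.log (π y)) i j x * v i * v j)
        + (3 - 2 * (d : ℝ)) / 8 * (∑ k, γ x k * v k) ^ 2
        - 1 / 8 * ((∑ k, γ x k ^ 2) * ∑ k, v k * v k)
        + (∑ k, pderiv' (fun y => Real.log (π y)) k x * v k) * ∑ k, γ x k * v k := by
  have expand : ∀ i j, Rtensor π γ i j x * v i * v j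
      = -(pderiv2 (fun y => Real.log (π y)) i j x * v i * v j)
        + (3 - 2 * (d : ℝ)) / 8 * ((γ x i * v i) * (γ x j * v j))
        - 1 / 8 * (if i = j then (∑ k, γ x k ^ 2) * (v i * v j) else 0)
        + 1 / 2 * ((γ x i * v i) * (pderiv' (fun y => Real.log (π y)) j x * v j))
        + 1 / 2 * ((pderiv' (fun y => Real.log (π y)) i x * v i) * (γ x j * v j)) := by
    intro i j
    unfold Rtensor
    split_ifs <;> ring
  simp only [expand, Finset.sum_add_distrib, Finset.sum_sub_distrib, Finset.sum_neg_distrib,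
    ← Finset.mul_sum, ← Finset.sum_mul, Finset.sum_ite_eq, Finset.mem_univ, if_true]
  ring

end PointwiseAlgebra

section FokkerPlanck

open scoped ContDiff

variable {d : ℕ} {π f : EuclideanSpace ℝ (Fin d) → ℝ}
  {γ : EuclideanSpace ℝ (Fin d) → EuclideanSpace ℝ (Fin d)}

lemma pderiv'_of_pos (hπ : ContDiff ℝ ∞ π) (hπpos : ∀ x, 0 < π x) (i : Fin d)
    (x : EuclideanSpace ℝ (Fin d)) :
    pderiv' π i x = π x * pderiv' (fun y => Real.log (π y)) i x := by
  have h := pderiv'_exp (hπ.log fun x => (hπpos x).ne') i x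
  simpa only [Real.exp_log (hπpos _)] using h

lemma pderiv'_mul_exp (hπ : ContDiff ℝ ∞ π) (hπpos : ∀ x, 0 < π x) (hf : ContDiff ℝ ∞ f)
    (i : Fin d) (x : EuclideanSpace ℝ (Fin d)) :
    pderiv' (fun y => π y * Real.exp (f y)) i x
      = π x * Real.exp (f x) * (pderiv' (fun y => Real.log (π y)) i x + pderiv' f i x) := by
  rw [pderiv'_mul hπ hf.exp, pderiv'_exp hf, pderiv'_of_pos hπ hπpos]
  ring

lemma pderiv'_density_mul (hπ : ContDiff ℝ ∞ π) (hπpos : ∀ x, 0 < π x) (hf : ContDiff ℝ ∞ f)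
    {w : EuclideanSpace ℝ (Fin d) → ℝ} (hw : ContDiff ℝ ∞ w)
    (i : Fin d) (x : EuclideanSpace ℝ (Fin d)) :
    pderiv' (fun y => π y * Real.exp (f y) * w y) i x
      = π x * Real.exp (f x)
        * ((pderiv' (fun y => Real.log (π y)) i x + pderiv' f i x) * w x + pderiv' w i x) := by
  rw [pderiv'_mul (hπ.mul hf.exp) hw, pderiv'_mul_exp hπ hπpos hf]
  ring

lemma stationarity_log (hπ : ContDiff ℝ ∞ π) (hπpos : ∀ x, 0 < π x) (hγ : ContDiff ℝ ∞ γ)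
    (hstat : ∀ x, ∑ i, pderiv' (fun y => π y * γ y i) i x = 0)
    (x : EuclideanSpace ℝ (Fin d)) :
    ∑ i, (pderiv' (fun y => Real.log (π y)) i x * γ x i + pderiv' (fun y => γ y i) i x) = 0 := by
  have h : π x * ∑ i, (pderiv' (fun y => Real.log (π y)) i x * γ x i
      + pderiv' (fun y => γ y i) i x) = 0 := by
    rw [← hstat x, Finset.mul_sum]
    refine Finset.sum_congr rfl fun i _ => ?_
    rw [pderiv'_mul hπ (contDiff_euclidean.1 hγ i), pderiv'_of_pos hπ hπpos]
    ring
  exact (mul_eq_zero.1 h).resolve_left (hπpos x).ne'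

/-- The relative rate `σ / p = L̃f + ‖∇f‖² + ⟨γ, ∇f⟩` of the Fokker–Planck flow at `p = π e^f`. -/
def logRate (π : EuclideanSpace ℝ (Fin d) → ℝ)
    (γ : EuclideanSpace ℝ (Fin d) → EuclideanSpace ℝ (Fin d))
    (f : EuclideanSpace ℝ (Fin d) → ℝ) (x : EuclideanSpace ℝ (Fin d)) : ℝ :=
  ∑ k, (pderiv' (fun y => Real.log (π y)) k x * pderiv' f k x + pderiv' (pderiv' f k) k x
    + pderiv' f k x * pderiv' f k x + γ x k * pderiv' f k x)

lemma FPrhs_density (hπ : ContDiff ℝ ∞ π) (hπpos : ∀ x, 0 < π x) (hγ : ContDiff ℝ ∞ γ)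
    (hstat : ∀ x, ∑ i, pderiv' (fun y => π y * γ y i) i x = 0) (hf : ContDiff ℝ ∞ f)
    (x : EuclideanSpace ℝ (Fin d)) :
    FPrhs π γ (fun z => π z * Real.exp (f z)) x = π x * Real.exp (f x) * logRate π γ f x := by
  have hu : ContDiff ℝ ∞ (fun y => Real.log (π y)) := hπ.log fun x => (hπpos x).ne'
  have hγi := contDiff_euclidean.1 hγ
  have hs := stationarity_log hπ hπpos hγ hstat x
  have drift : ∀ i, pderiv' (fun y => π y * Real.exp (f y)
        * (pderiv' (fun z => Real.log (π z)) i y - γ y i)) i x = _ := fun i =>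
    pderiv'_density_mul hπ hπpos hf ((hu.pderiv' i).sub (hγi i)) i x
  have diffusion : lap (fun z => π z * Real.exp (f z)) x
      = ∑ i, pderiv' (fun y => π y * Real.exp (f y)
        * (pderiv' (fun z => Real.log (π z)) i y + pderiv' f i y)) i x := by
    simp only [lap, pderiv2, pderiv'_mul_exp hπ hπpos hf]
  have diffusion' : ∀ i, pderiv' (fun y => π y * Real.exp (f y)
        * (pderiv' (fun z => Real.log (π z)) i y + pderiv' f i y)) i x = _ := fun i =>
    pderiv'_density_mul hπ hπpos hf ((hu.pderiv' i).add (hf.pderiv' i)) i x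
  rw [FPrhs, diffusion]
  simp only [drift, diffusion']
  rw [← sub_eq_zero, ← mul_zero (π x * Real.exp (f x)), ← hs, logRate]
  simp only [pderiv'_sub (hu.pderiv' _) (hγi _), pderiv'_add (hu.pderiv' _) (hf.pderiv' _)]
  rw [neg_add_eq_sub]
  simp only [Finset.mul_sum, ← Finset.sum_sub_distrib]
  refine Finset.sum_congr rfl fun i _ => ?_
  ring

lemma pderiv'_logRate (hπ : ContDiff ℝ ∞ π) (hπpos : ∀ x, 0 < π x) (hγ : ContDiff ℝ ∞ γ)
    (hf : ContDiff ℝ ∞ f) (j : Fin d) (x : EuclideanSpace ℝ (Fin d)) :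
    pderiv' (logRate π γ f) j x
      = ∑ k, (pderiv' (fun y => Real.log (π y)) k x * pderiv' (pderiv' f k) j x
          + pderiv' f k x * pderiv' (pderiv' (fun y => Real.log (π y)) k) j x
          + pderiv' (pderiv' (pderiv' f k) k) j x
          + 2 * (pderiv' f k x * pderiv' (pderiv' f k) j x)
          + (γ x k * pderiv' (pderiv' f k) j x
            + pderiv' f k x * pderiv' (fun y => γ y k) j x)) := by
  have hu : ∀ k, ContDiff ℝ ∞ (pderiv' (fun y => Real.log (π y)) k) :=
    (hπ.log fun x => (hπpos x).ne').pderiv'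
  have hγi := contDiff_euclidean.1 hγ
  have hg := hf.pderiv'
  have h1 := fun k => (hu k).mul (hg k)
  have h2 := fun k => (hg k).pderiv' k
  have h3 := fun k => (hg k).mul (hg k)
  have h4 := fun k => (hγi k).mul (hg k)
  unfold logRate
  rw [pderiv'_sum fun k => (((h1 k).add (h2 k)).add (h3 k)).add (h4 k)]
  refine Finset.sum_congr rfl fun k _ => ?_
  rw [pderiv'_add (((h1 k).add (h2 k)).add (h3 k)) (h4 k), pderiv'_add ((h1 k).add (h2 k)) (h3 k),
    pderiv'_add (h1 k) (h2 k), pderiv'_mul (hu k) (hg k), pderiv'_mul (hg k) (hg k),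
    pderiv'_mul (hγi k) (hg k)]
  ring

/-- The vector field `2⟨γ, ∇f⟩∇f - ‖∇f‖²γ + ‖∇f‖²∇f + ∇‖∇f‖²`, whose `p`-weighted divergence is
the difference between the Fisher information dissipation and the Bochner terms. -/
def fisherFlux (γ : EuclideanSpace ℝ (Fin d) → EuclideanSpace ℝ (Fin d))
    (f : EuclideanSpace ℝ (Fin d) → ℝ) (i : Fin d) (x : EuclideanSpace ℝ (Fin d)) : ℝ :=
  2 * ((∑ k, γ x k * pderiv' f k x) * pderiv' f i x)
    - (∑ k, pderiv' f k x * pderiv' f k x) * γ x i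
    + (∑ k, pderiv' f k x * pderiv' f k x) * pderiv' f i x
    + 2 * ∑ k, pderiv' f k x * pderiv' (pderiv' f k) i x

lemma ContDiff.fisherFlux (hγ : ContDiff ℝ ∞ γ) (hf : ContDiff ℝ ∞ f) (i : Fin d) :
    ContDiff ℝ ∞ (_root_.fisherFlux γ f i) := by
  have hγi := contDiff_euclidean.1 hγ
  have hg := hf.pderiv'
  have hG : ContDiff ℝ ∞ (fun x => ∑ k, _root_.pderiv' f k x * _root_.pderiv' f k x) :=
    ContDiff.sum fun k _ => (hg k).mul (hg k)
  have hs : ContDiff ℝ ∞ (fun x => ∑ k, γ x k * _root_.pderiv' f k x) :=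
    ContDiff.sum fun k _ => (hγi k).mul (hg k)
  exact (((contDiff_const.mul (hs.mul (hg i))).sub (hG.mul (hγi i))).add (hG.mul (hg i))).add
    (contDiff_const.mul (ContDiff.sum fun k _ => (hg k).mul ((hg k).pderiv' i)))

lemma pderiv'_fisherFlux (hγ : ContDiff ℝ ∞ γ) (hf : ContDiff ℝ ∞ f) (i : Fin d)
    (x : EuclideanSpace ℝ (Fin d)) :
    pderiv' (fisherFlux γ f i) i x
      = 2 * ((∑ k, γ x k * pderiv' f k x) * pderiv' (pderiv' f i) i x
          + pderiv' f i x * ∑ k, (γ x k * pderiv' (pderiv' f k) i x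
            + pderiv' f k x * pderiv' (fun y => γ y k) i x))
        - ((∑ k, pderiv' f k x * pderiv' f k x) * pderiv' (fun y => γ y i) i x
          + γ x i * (2 * ∑ k, pderiv' f k x * pderiv' (pderiv' f k) i x))
        + ((∑ k, pderiv' f k x * pderiv' f k x) * pderiv' (pderiv' f i) i x
          + pderiv' f i x * (2 * ∑ k, pderiv' f k x * pderiv' (pderiv' f k) i x))
        + 2 * ∑ k, (pderiv' f k x * pderiv' (pderiv' (pderiv' f k) i) i x
          + pderiv' (pderiv' f k) i x * pderiv' (pderiv' f k) i x) := by
  have hγi := contDiff_euclidean.1 hγ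
  have hg := hf.pderiv'
  have hG : ContDiff ℝ ∞ (fun x => ∑ k, pderiv' f k x * pderiv' f k x) :=
    ContDiff.sum fun k _ => (hg k).mul (hg k)
  have hs : ContDiff ℝ ∞ (fun x => ∑ k, γ x k * pderiv' f k x) :=
    ContDiff.sum fun k _ => (hγi k).mul (hg k)
  have hK : ContDiff ℝ ∞ (fun x => ∑ k, pderiv' f k x * pderiv' (pderiv' f k) i x) :=
    ContDiff.sum fun k _ => (hg k).mul ((hg k).pderiv' i)
  have dG : pderiv' (fun x => ∑ k, pderiv' f k x * pderiv' f k x) i x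
      = 2 * ∑ k, pderiv' f k x * pderiv' (pderiv' f k) i x := by
    rw [pderiv'_sum fun k => (hg k).mul (hg k), Finset.mul_sum]
    refine Finset.sum_congr rfl fun k _ => ?_
    rw [pderiv'_mul (hg k) (hg k)]
    ring
  have ds : pderiv' (fun x => ∑ k, γ x k * pderiv' f k x) i x
      = ∑ k, (γ x k * pderiv' (pderiv' f k) i x
            + pderiv' f k x * pderiv' (fun y => γ y k) i x) := by
    rw [pderiv'_sum fun k => (hγi k).mul (hg k)]
    exact Finset.sum_congr rfl fun k _ => pderiv'_mul (hγi k) (hg k) i x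
  have dK : pderiv' (fun x => ∑ k, pderiv' f k x * pderiv' (pderiv' f k) i x) i x
      = ∑ k, (pderiv' f k x * pderiv' (pderiv' (pderiv' f k) i) i x
          + pderiv' (pderiv' f k) i x * pderiv' (pderiv' f k) i x) := by
    rw [pderiv'_sum fun k => (hg k).mul ((hg k).pderiv' i)]
    exact Finset.sum_congr rfl fun k _ => pderiv'_mul (hg k) ((hg k).pderiv' i) i x
  have h1 := contDiff_const (c := (2 : ℝ)).mul (hs.mul (hg i))
  have h2 := hG.mul (hγi i)
  have h3 := hG.mul (hg i)
  unfold fisherFlux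
  rw [pderiv'_add ((h1.sub h2).add h3) (contDiff_const.mul hK), pderiv'_add (h1.sub h2) h3,
    pderiv'_sub h1 h2, pderiv'_const_mul (hs.mul (hg i)), pderiv'_mul hs (hg i),
    pderiv'_mul hG (hγi i), pderiv'_mul hG (hg i), pderiv'_const_mul hK, dG, ds, dK]

/-- Pointwise dissipation estimate: up to the divergence of `p • fisherFlux γ f`, the dissipation
of the Fisher information is bounded by its density. -/
lemma fisher_dissipation_pointwise (hπ : ContDiff ℝ ∞ π) (hπpos : ∀ x, 0 < π x)
    (hγ : ContDiff ℝ ∞ γ) (hstat : ∀ x, ∑ i, pderiv' (fun y => π y * γ y i) i x = 0)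
    {lam : ℝ} (hcond : ∀ (x v : EuclideanSpace ℝ (Fin d)),
      lam * ‖v‖ ^ 2 ≤ ∑ i, ∑ j, Rtensor π γ i j x * v i * v j)
    (hf : ContDiff ℝ ∞ f) (x : EuclideanSpace ℝ (Fin d)) :
    π x * Real.exp (f x) * (2 * Gamma1 f (logRate π γ f) x + Gamma1 f f x * logRate π γ f x)
      - ∑ i, pderiv' (fun y => π y * Real.exp (f y) * fisherFlux γ f i y) i x
      ≤ -2 * lam * (Gamma1 f f x * (π x * Real.exp (f x))) := by
  have hg := hf.pderiv'
  have hH : ∀ i j, pderiv' (pderiv' f j) i x = pderiv' (pderiv' f i) j x :=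
    fun i j => pderiv'_comm hf j i x
  have hT : ∀ i k, pderiv' (pderiv' (pderiv' f k) i) i x = pderiv' (pderiv' (pderiv' f i) i) k x := by
    intro i k
    rw [show pderiv' (pderiv' f k) i = pderiv' (pderiv' f i) k from
      funext fun y => pderiv'_comm hf k i y]
    exact pderiv'_comm (hg i) k i x
  have bochner := bochner_divergence_identity (fun i => pderiv' f i x) (fun i => γ x i)
    (fun i => pderiv' (fun y => Real.log (π y)) i x)
    (fun i j => pderiv' (pderiv' f j) i x)
    (fun i j => pderiv' (pderiv' (fun y => Real.log (π y)) j) i x)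
    (fun i j => pderiv' (fun y => γ y j) i x)
    (fun i j => pderiv' (pderiv' (pderiv' f j) j) i x) hH
    (stationarity_log hπ hπpos hγ hstat x)
  have square := modified_hessian_lower_bound (fun i => pderiv' f i x) (fun i => γ x i)
    (fun i j => pderiv' (pderiv' f j) i x) hH
  have curv := hcond x (WithLp.toLp 2 fun i => pderiv' f i x)
  rw [EuclideanSpace.real_norm_sq_eq,
    Rtensor_quadratic_form π γ x fun i => pderiv' f i x] at curv
  have hp : 0 < π x * Real.exp (f x) := mul_pos (hπpos x) (Real.exp_pos _)
  simp only [pderiv'_density_mul hπ hπpos hf (hγ.fisherFlux hf _), ← Finset.mul_sum,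
    pderiv'_fisherFlux hγ hf, hT]
  rw [← mul_sub, show -2 * lam * (Gamma1 f f x * (π x * Real.exp (f x)))
    = π x * Real.exp (f x) * (-2 * lam * Gamma1 f f x) by ring]
  refine mul_le_mul_of_nonneg_left ?_ hp.le
  simp only [Gamma1, pderiv'_logRate hπ hπpos hγ hf]
  refine bochner.trans_le ?_
  simp only [pow_two, pderiv2] at *
  linarith

lemma fisherFlux_eq_zero_of_notMem_tsupport (i : Fin d) {x : EuclideanSpace ℝ (Fin d)}
    (hx : x ∉ tsupport f) : fisherFlux γ f i x = 0 := by
  simp [fisherFlux, pderiv'_eq_zero_of_notMem_tsupport _ hx]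

end FokkerPlanck

/-- Theorem 2.2 (differential form): under the tensor condition `ℜ ⪰ λ I`, with
`p = π e^f`, `b = ∇ log π − γ`, `σ = −∇·(p b) + Δp`, the time derivative of the
relative Fisher information along the Fokker–Planck equation satisfies
`∫ (2⟨∇f, ∇(σ/p)⟩ p + ‖∇f‖² σ) ≤ −2λ ∫ ‖∇f‖² p`. -/
theorem fisher_information_dissipation_inequality
    (d : ℕ) (hd : 1 ≤ d)
    (π : EuclideanSpace ℝ (Fin d) → ℝ) (hπ : ContDiff ℝ (⊤ : ℕ∞) π)
    (hπpos : ∀ x, 0 < π x)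
    (γ : EuclideanSpace ℝ (Fin d) → EuclideanSpace ℝ (Fin d))
    (hγ : ContDiff ℝ (⊤ : ℕ∞) γ)
    (hstat : ∀ x, ∑ i, pderiv' (fun y => π y * γ y i) i x = 0)
    (lam : ℝ) (hlam : 0 < lam)
    (hcond : ∀ (x v : EuclideanSpace ℝ (Fin d)),
      lam * ‖v‖ ^ 2 ≤ ∑ i, ∑ j, Rtensor π γ i j x * v i * v j)
    (f : EuclideanSpace ℝ (Fin d) → ℝ) (hf : ContDiff ℝ (⊤ : ℕ∞) f)
    (hfc : HasCompactSupport f) :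
    (∫ x, (2 * Gamma1 f
            (fun y => FPrhs π γ (fun z => π z * Real.exp (f z)) y
              / (π y * Real.exp (f y))) x * (π x * Real.exp (f x))
          + Gamma1 f f x * FPrhs π γ (fun z => π z * Real.exp (f z)) x)) ≤
      -2 * lam * ∫ x, Gamma1 f f x * (π x * Real.exp (f x)) := by
  have hu : ContDiff ℝ (⊤ : ℕ∞) (fun y => Real.log (π y)) := hπ.log fun x => (hπpos x).ne'
  have hγi := contDiff_euclidean.1 hγ
  have hg := hf.pderiv'
  have hp : ContDiff ℝ (⊤ : ℕ∞) (fun x => π x * Real.exp (f x)) := hπ.mul hf.exp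
  have hS : ContDiff ℝ (⊤ : ℕ∞) (logRate π γ f) := ContDiff.sum fun k _ =>
    ((((hu.pderiv' k).mul (hg k)).add ((hg k).pderiv' k)).add ((hg k).mul (hg k))).add
      ((hγi k).mul (hg k))
  have hGam : ∀ {h : EuclideanSpace ℝ (Fin d) → ℝ}, ContDiff ℝ (⊤ : ℕ∞) h →
      ContDiff ℝ (⊤ : ℕ∞) (Gamma1 f h) := fun hh =>
    ContDiff.sum fun k _ => (hg k).mul (hh.pderiv' k)
  have hGam0 : ∀ (h : EuclideanSpace ℝ (Fin d) → ℝ) {x}, x ∉ tsupport f → Gamma1 f h x = 0 :=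
    fun h x hx => by simp [Gamma1, pderiv'_eq_zero_of_notMem_tsupport _ hx]
  have hrate : (fun y => FPrhs π γ (fun z => π z * Real.exp (f z)) y / (π y * Real.exp (f y)))
      = logRate π γ f := funext fun y => by
    rw [FPrhs_density hπ hπpos hγ hstat hf,
      mul_div_cancel_left₀ _ (mul_pos (hπpos y) (Real.exp_pos _)).ne']
  have hint : ∀ x, 2 * Gamma1 f (fun y => FPrhs π γ (fun z => π z * Real.exp (f z)) y
          / (π y * Real.exp (f y))) x * (π x * Real.exp (f x))
        + Gamma1 f f x * FPrhs π γ (fun z => π z * Real.exp (f z)) x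
      = π x * Real.exp (f x)
        * (2 * Gamma1 f (logRate π γ f) x + Gamma1 f f x * logRate π γ f x) := fun x => by
    rw [hrate, FPrhs_density hπ hπpos hγ hstat hf]
    ring
  simp only [hint]
  have hdiss : Integrable fun x => π x * Real.exp (f x)
      * (2 * Gamma1 f (logRate π γ f) x + Gamma1 f f x * logRate π γ f x) :=
    integrable_of_contDiff
      (hp.mul ((contDiff_const.mul (hGam hS)).add ((hGam hf).mul hS)))
      (HasCompactSupport.intro hfc fun x hx => by simp [hGam0 _ hx])
  have hfisher : Integrable fun x => Gamma1 f f x * (π x * Real.exp (f x)) :=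
    integrable_of_contDiff ((hGam hf).mul hp)
      (HasCompactSupport.intro hfc fun x hx => by simp [hGam0 _ hx])
  have hflux : ∀ i, ContDiff ℝ (⊤ : ℕ∞) fun x => π x * Real.exp (f x) * fisherFlux γ f i x :=
    fun i => hp.mul (hγ.fisherFlux hf i)
  have hfluxc : ∀ i, HasCompactSupport fun x => π x * Real.exp (f x) * fisherFlux γ f i x :=
    fun i => HasCompactSupport.intro hfc fun x hx => by
      simp [fisherFlux_eq_zero_of_notMem_tsupport i hx]
  have hdiv : Integrable fun x =>
      ∑ i, pderiv' (fun y => π y * Real.exp (f y) * fisherFlux γ f i y) i x :=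
    integrable_finsetSum _ fun i _ => integrable_pderiv' (hflux i) (hfluxc i) i
  have hdiv0 : ∫ x, ∑ i, pderiv' (fun y => π y * Real.exp (f y) * fisherFlux γ f i y) i x = 0 := by
    rw [integral_finsetSum _ fun i _ => integrable_pderiv' (hflux i) (hfluxc i) i]
    exact Finset.sum_eq_zero fun i _ => integral_pderiv'_eq_zero (hflux i) (hfluxc i) i
  have hmono := integral_mono (hdiss.sub hdiv) (hfisher.const_mul (-2 * lam))
    (fisher_dissipation_pointwise hπ hπpos hγ hstat hcond hf)
  simp only [Pi.sub_apply] at hmono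
  rwa [integral_sub hdiss hdiv, hdiv0, sub_zero, integral_const_mul] at hmono

end
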